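/- Fix a base class F of next-token generators and a thinking length T ≥ 1. For any m ≥ 1 and any m points (x_1,z_1),…,(x_m,z_m) ∈ {0,1}* × {0,1}^T, the number of distinct vectors |{(1[CoT_f^T(x_1) ≠ z_1], …, 1[CoT_f^T(x_m) ≠ z_m]) : f ∈ F}| is at most Γ_F(mT), where Γ_F is the growth function of F as a class of {0,1}-valued functions on {0,1}*. -/

import Mathlib

namespace CoTPaper

/-- Apply-and-append step of a next-token generator. -/
def appendStep (f : List Bool → Bool) (z : List Bool) : List Bool := z ++ [f z]

/-- End-to-end function after `T` autoregressive steps. -/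
def eteFn (f : List Bool → Bool) (T : ℕ) (x : List Bool) : Bool :=
  ((appendStep f)^[T] x).getLastD false

/-- Chain of thought: `CoT_f^T(x) = (ete_f^1(x),…,ete_f^T(x))`. -/
def cotFn (f : List Bool → Bool) (T : ℕ) (x : List Bool) : Fin T → Bool :=
  fun t => eteFn f ((t : ℕ) + 1) x

/-- Growth function of a class `F` of `{0,1}`-valued functions on `{0,1}^*`:
the maximum, over tuples of `m` points, of the number of behavior vectors of `F`. -/
noncomputable def growthFn (F : Set (List Bool → Bool)) (m : ℕ) : ℕ :=
  sSup {c : ℕ | ∃ s : Fin m → List Bool,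
    c = Set.ncard {v : Fin m → Bool | ∃ f ∈ F, v = fun i => f (s i)}}

theorem eteFn_succ (f : List Bool → Bool) (t : ℕ) (x : List Bool) :
    eteFn f (t + 1) x = f ((appendStep f)^[t] x) := by
  simp [eteFn, Function.iterate_succ_apply', appendStep]

/-- If the next token agrees with `z` along the generated string, or along the string prescribed
by `z`, then the two strings agree. -/
theorem iterate_appendStep_eq {f : List Bool → Bool} {T : ℕ} {x : List Bool} {z : Fin T → Bool}
    (h : ∀ t : Fin T, f ((appendStep f)^[t] x) = z t ∨ f (x ++ (List.ofFn z).take t) = z t)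
    {t : ℕ} (ht : t ≤ T) : (appendStep f)^[t] x = x ++ (List.ofFn z).take t := by
  induction t with
  | zero => simp
  | succ t ih =>
    have ih := ih (by omega)
    have hz : f (x ++ (List.ofFn z).take t) = z ⟨t, ht⟩ := by
      simpa [ih] using h ⟨t, ht⟩
    have hlen : t < (List.ofFn z).length := by simpa using ht
    rw [Function.iterate_succ_apply', ih, appendStep, hz, List.take_succ_eq_append_getElem hlen,
      List.getElem_ofFn, List.append_assoc]

theorem cotFn_eq_iff (f : List Bool → Bool) (T : ℕ) (x : List Bool) (z : Fin T → Bool) :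
    cotFn f T x = z ↔ ∀ t : Fin T, f (x ++ (List.ofFn z).take t) = z t := by
  simp only [funext_iff, cotFn, eteFn_succ]
  constructor <;> intro h t
  · rw [← iterate_appendStep_eq (fun t => Or.inl (h t)) t.2.le]
    exact h t
  · rw [iterate_appendStep_eq (fun t => Or.inr (h t)) t.2.le]
    exact h t

theorem ncard_le_growthFn (F : Set (List Bool → Bool)) {m : ℕ} (s : Fin m → List Bool) :
    Set.ncard {v : Fin m → Bool | ∃ f ∈ F, v = fun i => f (s i)} ≤ growthFn F m := by
  refine le_csSup ⟨Nat.card (Fin m → Bool), ?_⟩ ⟨s, rfl⟩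
  rintro _ ⟨s, rfl⟩
  exact Set.ncard_le_card _

/-- **Growth-function bound for the single-thinker CoT loss class.**  For any base class
`F`, thinking length `T ≥ 1`, `m ≥ 1` and any `m` points `(x_i, z_i) ∈ {0,1}^* × {0,1}^T`,
the number of distinct vectors `(1[CoT_f^T(x_1) ≠ z_1],…,1[CoT_f^T(x_m) ≠ z_m])` over
`f ∈ F` is at most `Γ_F(mT)`. -/
theorem stmt17 (F : Set (List Bool → Bool)) (T : ℕ) (hT : 1 ≤ T)
    (m : ℕ) (hm : 1 ≤ m) (p : Fin m → List Bool × (Fin T → Bool)) :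
    Set.ncard {v : Fin m → Bool | ∃ f ∈ F,
        v = fun i => decide (cotFn f T (p i).1 ≠ (p i).2)}
      ≤ growthFn F (m * T) := by
  let s : Fin (m * T) → List Bool := fun k =>
    (p (finProdFinEquiv.symm k).1).1 ++
      (List.ofFn (p (finProdFinEquiv.symm k).1).2).take (finProdFinEquiv.symm k).2
  let g : (Fin (m * T) → Bool) → Fin m → Bool := fun w i =>
    decide (¬ ∀ t : Fin T, w (finProdFinEquiv (i, t)) = (p i).2 t)
  refine le_trans ?_ (ncard_le_growthFn F s)
  refine le_trans (Set.ncard_le_ncard ?_ (Set.toFinite _)) (Set.ncard_image_le (f := g))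
  rintro _ ⟨f, hf, rfl⟩
  refine ⟨fun k => f (s k), ⟨f, hf, rfl⟩, ?_⟩
  funext i
  simp only [g, s, Equiv.symm_apply_apply, ne_eq, cotFn_eq_iff]

end CoTPaper
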